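/- Let ℏ, m, g, E₀, N > 0, set κ = √(2mE₀)/ℏ, let x₁ ≠ x₂ ∈ ℝ³ with R = |x₁ − x₂|, and define u(y) = Σ_{i=1}^2 e^{−κ|y−x_i|}/|y−x_i| for y ∉ {x₁,x₂}. For each n ≥ 0 define ψₙ(y₁,…,yₙ) = cₙ ∏_{j=1}^n u(y_j) with cₙ = N (−gm)ⁿ / ((2πℏ²)ⁿ √(n!)). Then for every n ≥ 0 and every (y₁,…,yₙ) with all y_j ∉ {x₁,x₂}: −(ℏ²/2m) Σ_{j=1}^n Δ_{y_j} ψₙ(y₁,…,yₙ) + n E₀ ψₙ(y₁,…,yₙ) + (g√(n+1)/4π) Σ_{i=1}^2 ∫_{S²} lim_{r→0} ∂_r [ r ψ_{n+1}(y₁,…,yₙ, x_i + rω) ] d²ω = E_min ψₙ(y₁,…,yₙ), where E_min = (g² m / πℏ²) ( √(2mE₀)/ℏ − e^{−√(2mE₀) R/ℏ}/R ). Consequently the two fixed sources effectively interact through an attractive Yukawa potential V(R) = const. − e^{−αR}/R. -/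

import Mathlib

open Real Complex Filter MeasureTheory Metric

/-- The Laplacian of a complex-valued function on `ℝ³`, as the sum of the second
partial derivatives in the coordinate directions. -/
noncomputable def laplacianC (f : EuclideanSpace ℝ (Fin 3) → ℂ)
    (y : EuclideanSpace ℝ (Fin 3)) : ℂ :=
  ∑ i : Fin 3,
    fderiv ℝ (fun z => fderiv ℝ f z (EuclideanSpace.single i 1)) y
      (EuclideanSpace.single i 1)

/-- The sectors of the dressed ground state of the two-source van Hove-type IBC model:
`ψₙ(y₁,…,yₙ) = cₙ ∏ⱼ u(yⱼ)` with `u(y) = Σᵢ e^{−κ|y−xᵢ|}/|y−xᵢ|` and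
`cₙ = N (−gm)ⁿ/((2πℏ²)ⁿ √n!)`. -/
noncomputable def twoSourceState (ℏ m g κ N : ℝ)
    (x₁ x₂ : EuclideanSpace ℝ (Fin 3)) (n : ℕ)
    (y : Fin n → EuclideanSpace ℝ (Fin 3)) : ℂ :=
  ((N * (-(g * m)) ^ n / ((2 * π * ℏ ^ 2) ^ n * Real.sqrt (Nat.factorial n)) *
      ∏ j, (Real.exp (-(κ * ‖y j - x₁‖)) / ‖y j - x₁‖
              + Real.exp (-(κ * ‖y j - x₂‖)) / ‖y j - x₂‖) : ℝ) : ℂ)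

noncomputable def yukU (κ : ℝ) (x₁ x₂ z : EuclideanSpace ℝ (Fin 3)) : ℝ :=
  Real.exp (-(κ * ‖z - x₁‖)) / ‖z - x₁‖ + Real.exp (-(κ * ‖z - x₂‖)) / ‖z - x₂‖

lemma radial_hasFDerivAt (F : ℝ → ℝ) (F' : ℝ) (a z : EuclideanSpace ℝ (Fin 3)) (hz : z ≠ a)
    (hF : HasDerivAt F F' ‖z - a‖) :
    HasFDerivAt (fun w => F ‖w - a‖) ((F' / ‖z - a‖) • innerSL ℝ (z - a)) z := by
  have hne : z - a ≠ 0 := sub_ne_zero.mpr hz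
  have hn : ‖z - a‖ ≠ 0 := norm_ne_zero_iff.mpr hne
  have h1 : HasFDerivAt (fun w : EuclideanSpace ℝ (Fin 3) => ‖w - a‖)
      ((1 / ‖z - a‖) • innerSL ℝ (z - a)) z := by
    have h2 : HasFDerivAt (fun w : EuclideanSpace ℝ (Fin 3) => ‖w - a‖ ^ 2)
        (2 • (innerSL ℝ (z - a)).comp (ContinuousLinearMap.id ℝ _)) z :=
      ((hasFDerivAt_id z).sub_const a).norm_sq
    have h3 := h2.sqrt (by positivity)
    have h4 : (fun w : EuclideanSpace ℝ (Fin 3) => ‖w - a‖) = fun w => √(‖w - a‖ ^ 2) := by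
      funext w; rw [Real.sqrt_sq (norm_nonneg _)]
    rw [h4]
    refine h3.congr_fderiv ?_
    rw [Real.sqrt_sq (norm_nonneg _)]
    ext v
    simp
    field_simp
  refine (hF.comp_hasFDerivAt z h1).congr_fderiv ?_
  ext v
  simp
  field_simp

lemma yuk_first (κ : ℝ) (a z : EuclideanSpace ℝ (Fin 3)) (hz : z ≠ a) :
    HasFDerivAt (fun w => Real.exp (-(κ * ‖w - a‖)) / ‖w - a‖)
      ((-(κ * ‖z - a‖ + 1) * Real.exp (-(κ * ‖z - a‖)) / ‖z - a‖ ^ 3) • innerSL ℝ (z - a)) z := by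
  have hn : ‖z - a‖ ≠ 0 := norm_ne_zero_iff.mpr (sub_ne_zero.mpr hz)
  have h : HasDerivAt (fun ρ : ℝ => Real.exp (-(κ * ρ)) / ρ)
      (-(κ * ‖z - a‖ + 1) * Real.exp (-(κ * ‖z - a‖)) / ‖z - a‖ ^ 2) ‖z - a‖ := by
    have h1 := ((((hasDerivAt_id ‖z - a‖).const_mul κ).neg).exp).div (hasDerivAt_id ‖z - a‖) hn
    refine h1.congr_deriv ?_
    simp
    field_simp
    ring
  refine (radial_hasFDerivAt _ _ a z hz h).congr_fderiv ?_
  congr 1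
  field_simp

lemma yuk_second (κ : ℝ) (a z : EuclideanSpace ℝ (Fin 3)) (hz : z ≠ a) (i : Fin 3) :
    ∃ L : EuclideanSpace ℝ (Fin 3) →L[ℝ] ℝ, HasFDerivAt
      (fun w : EuclideanSpace ℝ (Fin 3) =>
        (-(κ * ‖w - a‖ + 1) * Real.exp (-(κ * ‖w - a‖)) / ‖w - a‖ ^ 3) * (w - a) i) L z ∧
      L (EuclideanSpace.single i 1) =
        (-(κ * ‖z - a‖ + 1) * Real.exp (-(κ * ‖z - a‖)) / ‖z - a‖ ^ 3) +
        (κ ^ 2 * ‖z - a‖ ^ 2 + 3 * (κ * ‖z - a‖ + 1)) * Real.exp (-(κ * ‖z - a‖)) / ‖z - a‖ ^ 5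
          * ((z - a) i) ^ 2 := by
  have hn : ‖z - a‖ ≠ 0 := norm_ne_zero_iff.mpr (sub_ne_zero.mpr hz)
  have h : HasDerivAt (fun ρ : ℝ => -(κ * ρ + 1) * Real.exp (-(κ * ρ)) / ρ ^ 3)
      ((κ ^ 2 * ‖z - a‖ ^ 2 + 3 * (κ * ‖z - a‖ + 1)) * Real.exp (-(κ * ‖z - a‖)) / ‖z - a‖ ^ 4)
      ‖z - a‖ := by
    have h1 := (((((hasDerivAt_id ‖z - a‖).const_mul κ).add_const 1).neg).mul
      ((((hasDerivAt_id ‖z - a‖).const_mul κ).neg).exp)).div ((hasDerivAt_id ‖z - a‖).pow 3)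
      (pow_ne_zero 3 hn)
    refine h1.congr_deriv ?_
    simp
    field_simp
    ring
  have h2 := radial_hasFDerivAt _ _ a z hz h
  have h3 : HasFDerivAt (fun w : EuclideanSpace ℝ (Fin 3) => (w - a) i)
      (EuclideanSpace.proj i : EuclideanSpace ℝ (Fin 3) →L[ℝ] ℝ) z := by
    have := (EuclideanSpace.proj i : EuclideanSpace ℝ (Fin 3) →L[ℝ] ℝ).hasFDerivAt (x := z)
    simpa using this.sub_const (a i)
  refine ⟨_, h2.mul h3, ?_⟩
  simp [EuclideanSpace.inner_single_right]
  field_simp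

lemma fderiv_ofReal_of {f : EuclideanSpace ℝ (Fin 3) → ℝ} {L} {z : EuclideanSpace ℝ (Fin 3)}
    (h : HasFDerivAt f L z) :
    HasFDerivAt (fun w => ((f w : ℝ) : ℂ)) (Complex.ofRealCLM.comp L) z :=
  Complex.ofRealCLM.hasFDerivAt.comp z h

lemma lap_yukU (κ C : ℝ) (x₁ x₂ y : EuclideanSpace ℝ (Fin 3)) (h₁ : y ≠ x₁) (h₂ : y ≠ x₂) :
    laplacianC (fun z => ((C * yukU κ x₁ x₂ z : ℝ) : ℂ)) y
      = ((κ ^ 2 * (C * yukU κ x₁ x₂ y) : ℝ) : ℂ) := by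
  have hn₁ : ‖y - x₁‖ ≠ 0 := norm_ne_zero_iff.mpr (sub_ne_zero.mpr h₁)
  have hn₂ : ‖y - x₂‖ ≠ 0 := norm_ne_zero_iff.mpr (sub_ne_zero.mpr h₂)
  have key : ∀ i : Fin 3,
      fderiv ℝ (fun z => fderiv ℝ (fun z => ((C * yukU κ x₁ x₂ z : ℝ) : ℂ)) z
        (EuclideanSpace.single i 1)) y (EuclideanSpace.single i 1)
      = ((C * (((-(κ * ‖y - x₁‖ + 1) * Real.exp (-(κ * ‖y - x₁‖)) / ‖y - x₁‖ ^ 3) +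
        (κ ^ 2 * ‖y - x₁‖ ^ 2 + 3 * (κ * ‖y - x₁‖ + 1)) * Real.exp (-(κ * ‖y - x₁‖))
          / ‖y - x₁‖ ^ 5 * ((y - x₁) i) ^ 2) +
        ((-(κ * ‖y - x₂‖ + 1) * Real.exp (-(κ * ‖y - x₂‖)) / ‖y - x₂‖ ^ 3) +
        (κ ^ 2 * ‖y - x₂‖ ^ 2 + 3 * (κ * ‖y - x₂‖ + 1)) * Real.exp (-(κ * ‖y - x₂‖))
          / ‖y - x₂‖ ^ 5 * ((y - x₂) i) ^ 2)) : ℝ) : ℂ) := by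
    intro i
    obtain ⟨L₁, hL₁, e₁⟩ := yuk_second κ x₁ y h₁ i
    obtain ⟨L₂, hL₂, e₂⟩ := yuk_second κ x₂ y h₂ i
    have hev : (fun z => fderiv ℝ (fun z => ((C * yukU κ x₁ x₂ z : ℝ) : ℂ)) z
        (EuclideanSpace.single i 1)) =ᶠ[nhds y] (fun w => ((C * (
          (-(κ * ‖w - x₁‖ + 1) * Real.exp (-(κ * ‖w - x₁‖)) / ‖w - x₁‖ ^ 3) * (w - x₁) i +
          (-(κ * ‖w - x₂‖ + 1) * Real.exp (-(κ * ‖w - x₂‖)) / ‖w - x₂‖ ^ 3) * (w - x₂) i) : ℝ) : ℂ)) := by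
      filter_upwards [isOpen_ne.mem_nhds h₁, isOpen_ne.mem_nhds h₂] with w hw₁ hw₂
      have := fderiv_ofReal_of (((yuk_first κ x₁ w hw₁).add (yuk_first κ x₂ w hw₂)).const_mul C)
      erw [this.fderiv]
      simp [EuclideanSpace.inner_single_right]
      ring
    rw [hev.fderiv_eq]
    erw [(fderiv_ofReal_of ((hL₁.add hL₂).const_mul C)).fderiv]
    simp only [ContinuousLinearMap.comp_apply, ContinuousLinearMap.smul_apply,
      ContinuousLinearMap.add_apply, e₁, e₂, Complex.ofRealCLM_apply, smul_eq_mul]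
  unfold laplacianC
  simp only [key]
  rw [← Complex.ofReal_sum]
  congr 1
  have s₁ : ‖y - x₁‖ ^ 2 = ((y - x₁) 0) ^ 2 + ((y - x₁) 1) ^ 2 + ((y - x₁) 2) ^ 2 := by
    rw [EuclideanSpace.norm_sq_eq]; simp [Fin.sum_univ_three]
  have s₂ : ‖y - x₂‖ ^ 2 = ((y - x₂) 0) ^ 2 + ((y - x₂) 1) ^ 2 + ((y - x₂) 2) ^ 2 := by
    rw [EuclideanSpace.norm_sq_eq]; simp [Fin.sum_univ_three]
  have t : ∀ ρ a b c : ℝ, ρ ≠ 0 → ρ ^ 2 = a ^ 2 + b ^ 2 + c ^ 2 → ∀ P Q : ℝ,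
      (P + Q / ρ ^ 5 * a ^ 2) + (P + Q / ρ ^ 5 * b ^ 2) + (P + Q / ρ ^ 5 * c ^ 2)
        = 3 * P + Q / ρ ^ 3 := by
    intro ρ a b c hρ h P Q
    have : 3 * P + Q / ρ ^ 3 = 3 * P + Q / ρ ^ 5 * ρ ^ 2 := by field_simp
    rw [this, h]; ring
  rw [Fin.sum_univ_three]
  have T₁ := t _ _ _ _ hn₁ s₁ (-(κ * ‖y - x₁‖ + 1) * Real.exp (-(κ * ‖y - x₁‖)) / ‖y - x₁‖ ^ 3)
    ((κ ^ 2 * ‖y - x₁‖ ^ 2 + 3 * (κ * ‖y - x₁‖ + 1)) * Real.exp (-(κ * ‖y - x₁‖)))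
  have T₂ := t _ _ _ _ hn₂ s₂ (-(κ * ‖y - x₂‖ + 1) * Real.exp (-(κ * ‖y - x₂‖)) / ‖y - x₂‖ ^ 3)
    ((κ ^ 2 * ‖y - x₂‖ ^ 2 + 3 * (κ * ‖y - x₂‖ + 1)) * Real.exp (-(κ * ‖y - x₂‖)))
  have U : ∀ ρ E : ℝ, ρ ≠ 0 → 3 * (-(κ * ρ + 1) * E / ρ ^ 3) +
      (κ ^ 2 * ρ ^ 2 + 3 * (κ * ρ + 1)) * E / ρ ^ 3 = κ ^ 2 * (E / ρ) := by
    intro ρ E hρ; field_simp; ring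
  rw [U _ _ hn₁] at T₁
  rw [U _ _ hn₂] at T₂
  unfold yukU
  linear_combination C * T₁ + C * T₂

lemma yuk_lim (κ : ℝ) (D : ℝ) (a b ω : EuclideanSpace ℝ (Fin 3)) (hab : a ≠ b) (hω : ‖ω‖ = 1) :
    limUnder (nhdsWithin (0 : ℝ) (Set.Ioi 0)) (fun r : ℝ => deriv (fun s : ℝ =>
      (s : ℂ) * ((D * yukU κ a b (a + s • ω) : ℝ) : ℂ)) r)
    = ((D * (-κ + Real.exp (-(κ * ‖a - b‖)) / ‖a - b‖) : ℝ) : ℂ) := by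
  have hd : a - b ≠ 0 := sub_ne_zero.mpr hab
  have hn : ‖a - b‖ ≠ 0 := norm_ne_zero_iff.mpr hd
  apply Tendsto.limUnder_eq
  let q : ℝ → ℝ := fun s => Real.exp (-(κ * ‖(a - b) + s • ω‖)) / ‖(a - b) + s • ω‖
  let G : ℝ → ℝ := fun s => D * (Real.exp (-(κ * s)) + s * q s)
  have hnorm : ContDiffAt ℝ 2 (fun s : ℝ => ‖(a - b) + s • ω‖) 0 := by
    apply ContDiffAt.norm ℝ
    · fun_prop
    · simpa using hd
  have hq : ContDiffAt ℝ 2 q 0 := by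
    apply ContDiffAt.div
    · exact (contDiffAt_const.mul hnorm).neg.exp
    · exact hnorm
    · simpa using hn
  have hG : ContDiffAt ℝ 2 G 0 := by
    apply contDiffAt_const.mul
    apply ContDiffAt.add
    · fun_prop
    · exact contDiffAt_id.mul hq
  have hGc : ContinuousAt (deriv G) 0 := by
    have := (hG.fderiv_right (m := 1) (by norm_num)).continuousAt
    exact (this.clm_apply continuousAt_const)
  have hG0 : deriv G 0 = D * (-κ + Real.exp (-(κ * ‖a - b‖)) / ‖a - b‖) := by
    have hq' := (hq.differentiableAt (by norm_num)).hasDerivAt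
    have h1 := ((((hasDerivAt_id (0:ℝ)).const_mul κ).neg.exp).add
      ((hasDerivAt_id (0:ℝ)).mul hq')).const_mul D
    have h2 := h1.deriv
    have h3 : deriv G 0 = _ := h2
    rw [h3]
    simp [q]
  have hdiff : ∀ᶠ r in nhds (0:ℝ), DifferentiableAt ℝ G r := by
    have := hG.eventually (by simp)
    filter_upwards [this] with r hr using hr.differentiableAt (by norm_num)
  rw [← hG0]
  have hT : Tendsto (fun r => ((deriv G r : ℝ) : ℂ)) (nhdsWithin (0:ℝ) (Set.Ioi 0))
      (nhds ((deriv G 0 : ℝ) : ℂ)) :=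
    (Complex.continuous_ofReal.continuousAt.comp hGc).tendsto.mono_left nhdsWithin_le_nhds
  refine hT.congr' ?_
  filter_upwards [nhdsWithin_le_nhds hdiff, self_mem_nhdsWithin] with r hr hr0
  have hr0 : 0 < r := hr0
  have hev : (fun s : ℝ => (s : ℂ) * ((D * yukU κ a b (a + s • ω) : ℝ) : ℂ))
      =ᶠ[nhds r] fun s => ((G s : ℝ) : ℂ) := by
    filter_upwards [isOpen_Ioi.mem_nhds hr0] with s hs
    have hs : 0 < s := hs
    rw [← Complex.ofReal_mul]
    congr 1
    have e1 : a + s • ω - a = s • ω := by abel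
    have e2 : a + s • ω - b = (a - b) + s • ω := by abel
    simp only [yukU, G, q, e1, e2, norm_smul, hω, Real.norm_eq_abs, abs_of_pos hs, mul_one]
    field_simp
  rw [hev.deriv_eq]
  exact (hr.hasDerivAt.ofReal_comp).deriv.symm

lemma sphere_area : ((volume : Measure (EuclideanSpace ℝ (Fin 3))).toSphere).real Set.univ
    = 4 * π := by
  rw [Measure.real, Measure.toSphere_apply_univ]
  simp [EuclideanSpace.volume_ball_fin_three]
  rw [ENNReal.toReal_ofReal (by positivity)]
  ring

lemma state_eq (ℏ m g κ N : ℝ) (x₁ x₂ : EuclideanSpace ℝ (Fin 3)) (n : ℕ)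
    (y : Fin n → EuclideanSpace ℝ (Fin 3)) :
    twoSourceState ℏ m g κ N x₁ x₂ n y =
    ((N * (-(g * m)) ^ n / ((2 * π * ℏ ^ 2) ^ n * Real.sqrt (Nat.factorial n)) *
      ∏ j, yukU κ x₁ x₂ (y j) : ℝ) : ℂ) := rfl

lemma state_lap (ℏ m g κ N : ℝ) (x₁ x₂ : EuclideanSpace ℝ (Fin 3)) (n : ℕ)
    (y : Fin n → EuclideanSpace ℝ (Fin 3)) (j : Fin n) (h₁ : y j ≠ x₁) (h₂ : y j ≠ x₂) :
    laplacianC (fun z => twoSourceState ℏ m g κ N x₁ x₂ n (Function.update y j z)) (y j)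
      = (κ : ℂ) ^ 2 * twoSourceState ℏ m g κ N x₁ x₂ n y := by
  set c := N * (-(g * m)) ^ n / ((2 * π * ℏ ^ 2) ^ n * Real.sqrt (Nat.factorial n)) with hc
  have hz : ∀ z, twoSourceState ℏ m g κ N x₁ x₂ n (Function.update y j z) =
      (((c * ∏ k ∈ Finset.univ.erase j, yukU κ x₁ x₂ (y k)) * yukU κ x₁ x₂ z : ℝ) : ℂ) := by
    intro z
    rw [state_eq, ← hc, ← Finset.mul_prod_erase Finset.univ _ (Finset.mem_univ j)]
    congr 1
    rw [Function.update_self, Finset.prod_congr rfl (g := fun k => yukU κ x₁ x₂ (y k))]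
    · ring
    · intro k hk
      rw [Function.update_of_ne (Finset.ne_of_mem_erase hk)]
  simp only [hz]
  rw [lap_yukU κ _ x₁ x₂ _ h₁ h₂, ← Complex.ofReal_pow, Complex.ofReal_mul, ← hz,
    Function.update_eq_self]

lemma yukU_comm (κ : ℝ) (x₁ x₂ z : EuclideanSpace ℝ (Fin 3)) :
    yukU κ x₁ x₂ z = yukU κ x₂ x₁ z := add_comm _ _

lemma state_snoc (ℏ m g κ N : ℝ) (hℏ : 0 < ℏ) (x₁ x₂ : EuclideanSpace ℝ (Fin 3)) (n : ℕ)
    (y : Fin n → EuclideanSpace ℝ (Fin 3)) : ∃ D : ℝ,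
    (∀ z, twoSourceState ℏ m g κ N x₁ x₂ (n + 1) (Fin.snoc y z) =
      ((D * yukU κ x₁ x₂ z : ℝ) : ℂ)) ∧
    ((Real.sqrt ((n : ℝ) + 1) * D : ℝ) : ℂ) =
      ((-(g * m) / (2 * π * ℏ ^ 2) : ℝ) : ℂ) * twoSourceState ℏ m g κ N x₁ x₂ n y := by
  refine ⟨N * (-(g * m)) ^ (n + 1) / ((2 * π * ℏ ^ 2) ^ (n + 1) *
    Real.sqrt (Nat.factorial (n + 1))) * ∏ j, yukU κ x₁ x₂ (y j), ?_, ?_⟩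
  · intro z
    rw [state_eq, Fin.prod_univ_castSucc]
    simp only [Fin.snoc_castSucc, Fin.snoc_last]
    congr 1
    ring
  · rw [state_eq, ← Complex.ofReal_mul]
    congr 1
    have hs : Real.sqrt (Nat.factorial (n + 1)) =
        Real.sqrt ((n : ℝ) + 1) * Real.sqrt (Nat.factorial n) := by
      rw [Nat.factorial_succ, Nat.cast_mul, Real.sqrt_mul (by positivity)]
      push_cast; rfl
    have h1 : Real.sqrt ((n : ℝ) + 1) ≠ 0 := by positivity
    have h2 : Real.sqrt (Nat.factorial n) ≠ 0 := by positivity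
    have h3 := Real.pi_ne_zero
    rw [hs, pow_succ, pow_succ]
    field_simp

/-- **The two-source dressed state is an eigenfunction of the two-source IBC
Hamiltonian, sector by sector away from the sources, with eigenvalue
`E_min = (g²m/πℏ²)(√(2mE₀)/ℏ − e^{−√(2mE₀)R/ℏ}/R)`, `R = |x₁ − x₂|`.**
Consequently the two fixed sources effectively interact through an attractive Yukawa
potential `V(R) = const − e^{−αR}/R`. Here the Hamiltonian acts on the `n`-particle
sector by `(Hψ)(yⁿ) = −(ℏ²/2m) Σⱼ Δ_{yⱼ} ψ(yⁿ) + n E₀ ψ(yⁿ)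
  + (g√(n+1)/4π) Σᵢ ∫_{S²} lim_{r→0} ∂_r [r ψ(yⁿ, xᵢ + rω)] d²ω`,
`d²ω` being the surface measure on the unit sphere `S² ⊆ ℝ³`. -/
theorem twoSourceState_eigenfunction
    (ℏ m g E₀ N : ℝ) (hℏ : 0 < ℏ) (hm : 0 < m) (hg : 0 < g) (hE₀ : 0 < E₀) (hN : 0 < N)
    (κ : ℝ) (hκdef : κ = Real.sqrt (2 * m * E₀) / ℏ)
    (x₁ x₂ : EuclideanSpace ℝ (Fin 3)) (hx : x₁ ≠ x₂)
    (R : ℝ) (hRdef : R = ‖x₁ - x₂‖) :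
    ∀ (n : ℕ) (y : Fin n → EuclideanSpace ℝ (Fin 3)),
      (∀ j, y j ∉ ({x₁, x₂} : Set (EuclideanSpace ℝ (Fin 3)))) →
      -((ℏ : ℂ) ^ 2 / (2 * (m : ℂ))) *
          (∑ j : Fin n,
            laplacianC
              (fun z => twoSourceState ℏ m g κ N x₁ x₂ n (Function.update y j z)) (y j))
        + ((n : ℝ) * E₀ : ℝ) * twoSourceState ℏ m g κ N x₁ x₂ n y
        + ((g * Real.sqrt ((n : ℝ) + 1) / (4 * π)) : ℝ) *
            ∑ i : Fin 2,
              ∫ ω : sphere (0 : EuclideanSpace ℝ (Fin 3)) 1,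
                limUnder (nhdsWithin 0 (Set.Ioi 0))
                  (fun r : ℝ =>
                    deriv (fun s : ℝ =>
                      (s : ℂ) * twoSourceState ℏ m g κ N x₁ x₂ (n + 1)
                        (Fin.snoc y
                          ((if i = 0 then x₁ else x₂)
                            + s • (ω : EuclideanSpace ℝ (Fin 3))))) r)
                ∂((volume : Measure (EuclideanSpace ℝ (Fin 3))).toSphere)
      = ((g ^ 2 * m / (π * ℏ ^ 2)) *
          (Real.sqrt (2 * m * E₀) / ℏ - Real.exp (-(Real.sqrt (2 * m * E₀) * R / ℏ)) / R)
            : ℝ) * twoSourceState ℏ m g κ N x₁ x₂ n y := by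
  intro n y hy
  obtain ⟨D, hD, hDn⟩ := state_snoc ℏ m g κ N hℏ x₁ x₂ n y
  have hlap : ∀ j : Fin n, laplacianC
      (fun z => twoSourceState ℏ m g κ N x₁ x₂ n (Function.update y j z)) (y j)
      = (κ : ℂ) ^ 2 * twoSourceState ℏ m g κ N x₁ x₂ n y := by
    intro j
    have := hy j
    simp only [Set.mem_insert_iff, Set.mem_singleton_iff, not_or] at this
    exact state_lap ℏ m g κ N x₁ x₂ n y j this.1 this.2
  have hRpos : 0 < R := by rw [hRdef]; exact norm_pos_iff.mpr (sub_ne_zero.mpr hx)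
  have hint : ∀ i : Fin 2, (∫ ω : sphere (0 : EuclideanSpace ℝ (Fin 3)) 1,
      limUnder (nhdsWithin 0 (Set.Ioi 0))
        (fun r : ℝ => deriv (fun s : ℝ => (s : ℂ) * twoSourceState ℏ m g κ N x₁ x₂ (n + 1)
          (Fin.snoc y ((if i = 0 then x₁ else x₂) + s • (ω : EuclideanSpace ℝ (Fin 3))))) r)
        ∂((volume : Measure (EuclideanSpace ℝ (Fin 3))).toSphere))
      = ((4 * π * (D * (-κ + Real.exp (-(κ * R)) / R)) : ℝ) : ℂ) := by
    intro i
    have hl : ∀ ω : sphere (0 : EuclideanSpace ℝ (Fin 3)) 1,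
      limUnder (nhdsWithin 0 (Set.Ioi 0))
        (fun r : ℝ => deriv (fun s : ℝ => (s : ℂ) * twoSourceState ℏ m g κ N x₁ x₂ (n + 1)
          (Fin.snoc y ((if i = 0 then x₁ else x₂) + s • (ω : EuclideanSpace ℝ (Fin 3))))) r)
        = ((D * (-κ + Real.exp (-(κ * R)) / R) : ℝ) : ℂ) := by
      intro ω
      have hω : ‖(ω : EuclideanSpace ℝ (Fin 3))‖ = 1 := by simp
      simp only [hD]
      by_cases hi : i = 0
      · simp only [hi, if_true]
        rw [yuk_lim κ D x₁ x₂ ω hx hω, hRdef]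
      · simp only [hi, if_false]
        simp only [yukU_comm κ x₁ x₂]
        rw [yuk_lim κ D x₂ x₁ ω hx.symm hω, hRdef, norm_sub_rev]
    simp only [hl]
    rw [integral_const, sphere_area, Complex.real_smul, ← Complex.ofReal_mul]
  simp only [hlap, hint]
  have hk2 : κ ^ 2 = 2 * m * E₀ / ℏ ^ 2 := by
    rw [hκdef, div_pow, Real.sq_sqrt (by positivity)]
  have hk2c : (κ : ℂ) ^ 2 = 2 * m * E₀ / (ℏ : ℂ) ^ 2 := by exact_mod_cast hk2
  have hexp : Real.exp (-(Real.sqrt (2 * m * E₀) * R / ℏ)) = Real.exp (-(κ * R)) := by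
    rw [hκdef]; congr 2; ring
  rw [hexp, ← hκdef, Finset.sum_const, Finset.sum_const, Finset.card_univ, Finset.card_univ,
    Fintype.card_fin, Fintype.card_fin, hk2c]
  set W := twoSourceState ℏ m g κ N x₁ x₂ n y
  set e := Real.exp (-(κ * R)) / R
  have hpi : (π : ℂ) ≠ 0 := by exact_mod_cast Real.pi_ne_zero
  have hℏc : (ℏ : ℂ) ≠ 0 := by exact_mod_cast hℏ.ne'
  have hmc : (m : ℂ) ≠ 0 := by exact_mod_cast hm.ne'
  push_cast at hDn ⊢
  simp only [nsmul_eq_mul]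
  push_cast
  have A : -((ℏ : ℂ) ^ 2 / (2 * (m : ℂ))) * ((n : ℂ) * (2 * m * E₀ / (ℏ : ℂ) ^ 2 * W))
      + n * E₀ * W = 0 := by
    field_simp
    ring
  have B : ∀ S : ℂ, (g : ℂ) * S / (4 * π) * (2 * (4 * π * (D * (-κ + e))))
      = 2 * g * (-κ + e) * (S * D) := by
    intro S
    field_simp
    try ring
  rw [A, zero_add, B, hDn]
  field_simp
  ring
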